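/- arXiv:1706.01877 — 2 statements merged into one kernel-verified Lean document; each statement's English description precedes it below -/
import Mathlib

section
/- Let A be a unital C*-algebra and let (a_n) be a sequence of group invertible (equivalently, core invertible, equivalently dual core invertible) elements of A converging in norm to 0. The following statements are equivalent: (i) (a_n#) converges to 0; (ii) (a_n⊕) converges to 0; (iii) (a_n⊖) converges to 0; (iv) the sequence (a_n#) is bounded; (v) there exists n₀ such that a_n = 0 for all n ≥ n₀. Moreover, either a_n = 0 for all sufficiently large n, or the sequence (a_n#) is unbounded; and (a_n#) is unbounded if and only if (a_n⊕) is unbounded, if and only if (a_n⊖) is unbounded. -/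
open scoped Classical

/-- `x` is a Moore–Penrose inverse of `a`. -/
def IsMPInv {A : Type*} [Ring A] [StarRing A] (a x : A) : Prop :=
  a * x * a = a ∧ x * a * x = x ∧ star (a * x) = a * x ∧ star (x * a) = x * a

/-- `x` is a group inverse of `a`. -/
def IsGroupInv {A : Type*} [Ring A] (a x : A) : Prop :=
  a * x * a = a ∧ x * a * x = x ∧ a * x = x * a

/-- `x` is a core inverse of `a`: `a·x·a = a`, `x·A = a·A`, `A·x = A·a*`. -/
def IsCoreInv {A : Type*} [Ring A] [StarRing A] (a x : A) : Prop :=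
  a * x * a = a ∧ (Set.range fun y => x * y) = (Set.range fun y => a * y) ∧
    (Set.range fun y => y * x) = (Set.range fun y => y * star a)

/-- `x` is a dual core inverse of `a`: `a·x·a = a`, `x·A = a*·A`, `A·x = A·a`. -/
def IsDualCoreInv {A : Type*} [Ring A] [StarRing A] (a x : A) : Prop :=
  a * x * a = a ∧ (Set.range fun y => x * y) = (Set.range fun y => star a * y) ∧
    (Set.range fun y => y * x) = (Set.range fun y => y * a)

/-- The Moore–Penrose inverse `a†` (or `0` if it does not exist). -/
noncomputable def mpInv {A : Type*} [Ring A] [StarRing A] (a : A) : A :=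
  if h : ∃ x, IsMPInv a x then h.choose else 0

/-- The group inverse `a#` (or `0` if it does not exist). -/
noncomputable def groupInv {A : Type*} [Ring A] (a : A) : A :=
  if h : ∃ x, IsGroupInv a x then h.choose else 0

/-- The core inverse `a⊕` (or `0` if it does not exist). -/
noncomputable def coreInv {A : Type*} [Ring A] [StarRing A] (a : A) : A :=
  if h : ∃ x, IsCoreInv a x then h.choose else 0

/-- The dual core inverse `a⊖` (or `0` if it does not exist). -/
noncomputable def dualCoreInv {A : Type*} [Ring A] [StarRing A] (a : A) : A :=
  if h : ∃ x, IsDualCoreInv a x then h.choose else 0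

/-- The maximal angle `ψ_a ∈ [0, π/2]` between `a·a†` and `a†·a`, defined by
`sin ψ_a = ‖a·a† − a†·a‖` (and `ψ_a = 0` when `a = 0`). -/
noncomputable def maxAngle {A : Type*} [NormedRing A] [StarRing A] (a : A) : ℝ :=
  Real.arcsin ‖a * mpInv a - mpInv a * a‖

/-- `δ(M, N)`: zero if `M = {0}`, otherwise the supremum of distances from
norm-one elements of `M` to `N`. -/
noncomputable def subDelta {E : Type*} [NormedAddCommGroup E] (M N : Set E) : ℝ :=
  if M = {0} then 0
  else sSup ((fun m => Metric.infDist m N) '' {m ∈ M | ‖m‖ = 1})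

/-- The gap `θ(M, N)` between the subspaces `M` and `N`. -/
noncomputable def subGap {E : Type*} [NormedAddCommGroup E] (M N : Set E) : ℝ :=
  max (subDelta M N) (subDelta N M)

/-- The right ideal `a·A`. -/
def rIdeal {A : Type*} [Ring A] (a : A) : Set A := Set.range fun y => a * y

/-- The left ideal `A·a`. -/
def lIdeal {A : Type*} [Ring A] (a : A) : Set A := Set.range fun y => y * a

/-- The right annihilator `a° = {x : a·x = 0}`. -/
def rAnn {A : Type*} [Ring A] (a : A) : Set A := {x | a * x = 0}

/-- The left annihilator `°a = {x : x·a = 0}`. -/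
def lAnn {A : Type*} [Ring A] (a : A) : Set A := {x | x * a = 0}

section GroupInv

variable {A : Type*} [Ring A] {a g : A}

protected theorem IsGroupInv.star [StarRing A] (h : IsGroupInv a g) : IsGroupInv (star a) (star g) := by
  obtain ⟨h₁, h₂, h₃⟩ := h
  refine ⟨?_, ?_, ?_⟩
  · simpa only [star_mul, ← mul_assoc] using congrArg star h₁
  · simpa only [star_mul, ← mul_assoc] using congrArg star h₂
  · simpa only [star_mul] using (congrArg star h₃).symm

theorem isGroupInv_groupInv (h : ∃ x, IsGroupInv a x) : IsGroupInv a (groupInv a) := by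
  rw [groupInv, dif_pos h]
  exact h.choose_spec

theorem isCoreInv_coreInv [StarRing A] (h : ∃ x, IsCoreInv a x) : IsCoreInv a (coreInv a) := by
  rw [coreInv, dif_pos h]
  exact h.choose_spec

theorem isDualCoreInv_dualCoreInv [StarRing A] (h : ∃ x, IsDualCoreInv a x) :
    IsDualCoreInv a (dualCoreInv a) := by
  rw [dualCoreInv, dif_pos h]
  exact h.choose_spec

theorem range_mul_right_star [StarRing A] {b c : A}
    (h : (Set.range fun y => b * y) = Set.range fun y => c * y) :
    (Set.range fun y => y * star b) = Set.range fun y => y * star c := by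
  have key : ∀ d : A, (Set.range fun y => y * star d) = star '' Set.range fun y => d * y := by
    intro d
    ext z
    constructor
    · rintro ⟨y, rfl⟩
      exact ⟨_, ⟨star y, rfl⟩, by simp⟩
    · rintro ⟨_, ⟨y, rfl⟩, rfl⟩
      exact ⟨star y, by simp⟩
  rw [key, key, h]

theorem range_mul_left_star [StarRing A] {b c : A}
    (h : (Set.range fun y => y * b) = Set.range fun y => y * c) :
    (Set.range fun y => star b * y) = Set.range fun y => star c * y := by
  have key : ∀ d : A, (Set.range fun y => star d * y) = star '' Set.range fun y => y * d := by
    intro d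
    ext z
    constructor
    · rintro ⟨y, rfl⟩
      exact ⟨_, ⟨star y, rfl⟩, by simp⟩
    · rintro ⟨_, ⟨y, rfl⟩, rfl⟩
      exact ⟨star y, by simp⟩
  rw [key, key, h]

protected theorem IsDualCoreInv.star [StarRing A] {x : A} (h : IsDualCoreInv a x) :
    IsCoreInv (star a) (star x) := by
  obtain ⟨h₁, h₂, h₃⟩ := h
  refine ⟨?_, range_mul_left_star h₃, range_mul_right_star h₂⟩
  simpa only [star_mul, ← mul_assoc] using congrArg star h₁

protected theorem IsCoreInv.star [StarRing A] {x : A} (h : IsCoreInv a x) :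
    IsDualCoreInv (star a) (star x) := by
  obtain ⟨h₁, h₂, h₃⟩ := h
  refine ⟨?_, range_mul_left_star h₃, range_mul_right_star h₂⟩
  simpa only [star_mul, ← mul_assoc] using congrArg star h₁

theorem IsCoreInv.isSelfAdjoint_mul [StarRing A] {x : A} (h : IsCoreInv a x) :
    IsSelfAdjoint (a * x) := by
  obtain ⟨h₁, -, h₃⟩ := h
  obtain ⟨y, hy⟩ : x ∈ Set.range fun y => y * star a := h₃ ▸ ⟨1, one_mul x⟩
  have hx : x = x * star (a * x) := by
    have h₁' := congrArg star h₁
    simp only [star_mul] at h₁' hy ⊢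
    grind
  have : a * x = a * x * star (a * x) := by rw [mul_assoc, ← hx]
  rw [this]
  exact IsSelfAdjoint.mul_star_self _

theorem IsCoreInv.isIdempotentElem_mul [StarRing A] {x : A} (h : IsCoreInv a x) :
    IsIdempotentElem (a * x) := by
  rw [IsIdempotentElem, ← mul_assoc, h.1]

theorem IsCoreInv.mul_mul_self [StarRing A] {x : A} (h : IsCoreInv a x) : x * a * x = x := by
  have hs := h.isSelfAdjoint_mul.star_eq
  obtain ⟨h₁, -, h₃⟩ := h
  obtain ⟨y, hy⟩ : x ∈ Set.range fun y => y * star a := h₃ ▸ ⟨1, one_mul x⟩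
  have h₁' := congrArg star h₁
  simp only [star_mul] at h₁' hy hs
  grind

theorem IsCoreInv.mul_eq_groupInv_mul [StarRing A] {x : A} (h : IsCoreInv a x)
    (hg : IsGroupInv a g) : x * a = g * a := by
  have hx := h.mul_mul_self
  obtain ⟨h₁, h₂, -⟩ := h
  obtain ⟨u, hu⟩ : a ∈ Set.range fun y => x * y := h₂ ▸ ⟨1, mul_one a⟩
  obtain ⟨g₁, g₂, g₃⟩ := hg
  have hxaa : x * a * a = a := by
    simp only at hu
    nth_rewrite 2 [← hu]
    rw [← mul_assoc, hx, hu]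
  calc x * a = x * (a * (g * a)) := by rw [← mul_assoc a, g₁]
    _ = x * a * a * g := by rw [← g₃]; noncomm_ring
    _ = g * a := by rw [hxaa, g₃]

theorem IsCoreInv.eq_groupInv_mul [StarRing A] {x : A} (h : IsCoreInv a x)
    (hg : IsGroupInv a g) : x = g * (a * x) := by
  rw [← mul_assoc, ← h.mul_eq_groupInv_mul hg, h.mul_mul_self]

theorem IsCoreInv.groupInv_eq [StarRing A] {x : A} (h : IsCoreInv a x)
    (hg : IsGroupInv a g) : g = x * x * a := by
  have := h.mul_eq_groupInv_mul hg
  rw [mul_assoc, this, ← hg.2.2, ← mul_assoc, this, hg.2.1]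

end GroupInv

section Norm

theorem IsIdempotentElem.eq_zero_of_norm_lt_one {A : Type*} [NormedRing A] {p : A}
    (hp : IsIdempotentElem p) (h : ‖p‖ < 1) : p = 0 := by
  have := norm_mul_le p p
  rw [hp.eq] at this
  rw [← norm_le_zero_iff]
  nlinarith [norm_nonneg p]

variable {A : Type*} [NormedRing A] [StarRing A] {a x g : A}

theorem IsCoreInv.norm_groupInv_le (h : IsCoreInv a x) (hg : IsGroupInv a g) :
    ‖g‖ ≤ ‖x‖ * ‖x‖ * ‖a‖ := by
  rw [h.groupInv_eq hg]
  exact norm_mul₃_le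

variable [CStarRing A]

theorem IsSelfAdjoint.norm_le_one_of_isIdempotentElem {e : A} (hs : IsSelfAdjoint e)
    (he : IsIdempotentElem e) : ‖e‖ ≤ 1 := by
  have := CStarRing.norm_star_mul_self (x := e)
  rw [hs.star_eq, he.eq] at this
  nlinarith [norm_nonneg e]

theorem IsCoreInv.norm_le (h : IsCoreInv a x) (hg : IsGroupInv a g) : ‖x‖ ≤ ‖g‖ := by
  have he := h.isSelfAdjoint_mul.norm_le_one_of_isIdempotentElem h.isIdempotentElem_mul
  calc ‖x‖ = ‖g * (a * x)‖ := by rw [← h.eq_groupInv_mul hg]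
    _ ≤ ‖g‖ * ‖a * x‖ := norm_mul_le _ _
    _ ≤ ‖g‖ := mul_le_of_le_one_right (norm_nonneg _) he

theorem IsDualCoreInv.norm_le (h : IsDualCoreInv a x) (hg : IsGroupInv a g) : ‖x‖ ≤ ‖g‖ := by
  simpa only [norm_star] using h.star.norm_le hg.star

theorem IsDualCoreInv.norm_groupInv_le (h : IsDualCoreInv a x) (hg : IsGroupInv a g) :
    ‖g‖ ≤ ‖x‖ * ‖x‖ * ‖a‖ := by
  simpa only [norm_star] using h.star.norm_groupInv_le hg.star

end Norm

section Existence

variable {A : Type*} [CStarAlgebra A]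

theorem isUnit_one_add_of_star_eq_neg {z : A} (hz : star z = -z) : IsUnit (1 + z) := by
  have hsa : IsSelfAdjoint (Complex.I • z) := by
    rw [IsSelfAdjoint, star_smul, hz]
    simp
  have hI : -Complex.I ∉ spectrum ℂ (Complex.I • z) := fun hmem => by
    have := congrArg Complex.im (hsa.mem_spectrum_eq_re hmem)
    simp at this
  rw [spectrum.notMem_iff] at hI
  have : algebraMap ℂ A (-Complex.I) - Complex.I • z = algebraMap ℂ A (-Complex.I) * (1 + z) := by
    rw [Algebra.algebraMap_eq_smul_one, smul_mul_assoc, one_mul, smul_add, neg_smul, neg_smul,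
      sub_eq_add_neg]
  rw [this] at hI
  have hu : IsUnit (algebraMap ℂ A (-Complex.I)) :=
    (IsUnit.mk0 _ (neg_ne_zero.mpr Complex.I_ne_zero)).map _
  exact hu.mul_left_iff.mp hI

/-- In a C⋆-algebra, every idempotent has the same range as a self-adjoint idempotent. -/
theorem exists_isSelfAdjoint_of_isIdempotentElem {p : A} (hp : IsIdempotentElem p) :
    ∃ q : A, IsSelfAdjoint q ∧ q * p = p ∧ p * q = q := by
  have hp' : star p * star p = star p := by rw [← star_mul, hp.eq]
  have hpp : p * p = p := hp
  have hsq : IsUnit ((p + star p - 1) * (p + star p - 1)) := by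
    have h₁ : IsUnit (1 + (p - star p)) := isUnit_one_add_of_star_eq_neg (by simp)
    have h₂ : IsUnit (1 + (star p - p)) := isUnit_one_add_of_star_eq_neg (by simp)
    have : (p + star p - 1) * (p + star p - 1) = (1 + (p - star p)) * (1 + (star p - p)) := by
      simp only [mul_add, add_mul, mul_sub, sub_mul, hpp, hp', mul_one, one_mul]
      abel
    rw [this]
    exact h₁.mul h₂
  obtain ⟨u, hu⟩ : IsUnit (p + star p - 1) :=
    (Commute.refl (p + star p - 1)).isUnit_mul_iff.mp hsq |>.1
  have hup : (u : A) * p = star p * p := by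
    rw [hu]; simp only [add_mul, sub_mul, hpp, one_mul]; abel
  have hpu : star p * (u : A) = star p * p := by
    rw [hu]; simp only [mul_add, mul_sub, hp', mul_one]; abel
  have hus : star (u : A) = u := by rw [hu]; simp [add_comm]
  have huinv : star (↑u⁻¹ : A) = ↑u⁻¹ := by
    have : star (↑u⁻¹ : A) * u = 1 := by
      rw [← hus, ← star_mul, Units.mul_inv, star_one]
    exact Units.eq_inv_of_mul_eq_one_right this
  have hcomm : p * (↑u⁻¹ : A) = ↑u⁻¹ * star p := by
    rw [Units.eq_inv_mul_iff_mul_eq, ← mul_assoc, Units.mul_inv_eq_iff_eq_mul, hup, hpu]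
  refine ⟨p * (↑u⁻¹ : A), ?_, ?_, ?_⟩
  · rw [IsSelfAdjoint, star_mul, huinv, hcomm]
  · rw [hcomm, mul_assoc, ← hup, Units.inv_mul_cancel_left]
  · rw [← mul_assoc, hpp]

theorem IsGroupInv.exists_isCoreInv {a g : A} (hg : IsGroupInv a g) : ∃ x, IsCoreInv a x := by
  obtain ⟨g₁, g₂, g₃⟩ := hg
  have hp : IsIdempotentElem (a * g) := by rw [IsIdempotentElem, ← mul_assoc, g₁]
  obtain ⟨q, hq, hqp, hpq⟩ := exists_isSelfAdjoint_of_isIdempotentElem hp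
  have hqa : q * a = a := by rw [← g₁, ← mul_assoc q, hqp]
  have hax : a * (g * q) = q := by rw [← mul_assoc, hpq]
  have hqs : star q = q := hq
  refine ⟨g * q, by rw [hax, hqa], ?_, ?_⟩
  · apply Set.Subset.antisymm
    · rintro _ ⟨y, rfl⟩
      refine ⟨g * g * q * y, ?_⟩
      simp only [← mul_assoc]
      rw [g₃, g₂]
    · rintro _ ⟨y, rfl⟩
      refine ⟨a * a * y, ?_⟩
      simp only [← mul_assoc]
      rw [mul_assoc g q a, hqa, ← g₃, g₁]
  · apply Set.Subset.antisymm
    · rintro _ ⟨y, rfl⟩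
      refine ⟨y * g * star (g * q), ?_⟩
      simp only
      rw [mul_assoc, ← star_mul, hax, hqs, mul_assoc]
    · rintro _ ⟨y, rfl⟩
      refine ⟨y * star a * a, ?_⟩
      simp only
      rw [mul_assoc, hax, mul_assoc, ← hqs, ← star_mul, hqa]

theorem IsGroupInv.exists_isDualCoreInv {a g : A} (hg : IsGroupInv a g) :
    ∃ x, IsDualCoreInv a x := by
  obtain ⟨x, hx⟩ := hg.star.exists_isCoreInv
  exact ⟨star x, star_star a ▸ hx.star⟩

end Existence

section Sequence

open Filter Topology

variable {A : Type*} [NormedRing A] {s g x : ℕ → A}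

theorem eventually_eq_zero_of_bounded_groupInv (hg : ∀ n, IsGroupInv (s n) (g n))
    (hs : Tendsto s atTop (𝓝 0)) (hb : ∃ C, ∀ n, ‖g n‖ ≤ C) : ∃ n₀, ∀ n ≥ n₀, s n = 0 := by
  obtain ⟨C, hC⟩ := hb
  have hlim : Tendsto (fun n => s n * g n) atTop (𝓝 0) := by
    refine squeeze_zero_norm (a := fun n => ‖s n‖ * C) (fun n => ?_) ?_
    · exact (norm_mul_le _ _).trans (mul_le_mul_of_nonneg_left (hC n) (norm_nonneg _))
    · simpa using hs.norm.mul_const C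
  have hlt : ∀ᶠ n in atTop, ‖s n * g n‖ < 1 :=
    hlim.norm.eventually_lt_const (by simp)
  obtain ⟨n₀, hn₀⟩ := eventually_atTop.mp hlt
  refine ⟨n₀, fun n hn => ?_⟩
  have hp : IsIdempotentElem (s n * g n) := by rw [IsIdempotentElem, ← mul_assoc, (hg n).1]
  rw [← (hg n).1, hp.eq_zero_of_norm_lt_one (hn₀ n hn), zero_mul]

theorem bounded_of_tendsto_zero (hx : Tendsto x atTop (𝓝 0)) : ∃ C, ∀ n, ‖x n‖ ≤ C := by
  obtain ⟨C, hC⟩ := hx.norm.bddAbove_range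
  exact ⟨C, fun n => hC ⟨n, rfl⟩⟩

theorem bounded_groupInv_iff (hs : Tendsto s atTop (𝓝 0)) (hle : ∀ n, ‖x n‖ ≤ ‖g n‖)
    (hge : ∀ n, ‖g n‖ ≤ ‖x n‖ * ‖x n‖ * ‖s n‖) :
    (∃ C, ∀ n, ‖g n‖ ≤ C) ↔ ∃ C, ∀ n, ‖x n‖ ≤ C := by
  refine ⟨fun ⟨C, hC⟩ => ⟨C, fun n => (hle n).trans (hC n)⟩, fun ⟨C, hC⟩ => ?_⟩
  obtain ⟨D, hD⟩ := bounded_of_tendsto_zero hs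
  have hC₀ : 0 ≤ C := (norm_nonneg _).trans (hC 0)
  refine ⟨C * C * D, fun n => (hge n).trans ?_⟩
  have := hC n
  have := hD n
  gcongr

end Sequence

theorem stmt7 {A : Type*} [NormedRing A] [StarRing A] [CStarRing A]
    [CompleteSpace A] [NormedAlgebra ℂ A] [StarModule ℂ A]
    (s : ℕ → A) (hs : ∀ n, ∃ x, IsGroupInv (s n) x)
    (hconv : Filter.Tendsto s Filter.atTop (nhds (0 : A))) :
    List.TFAE
      [Filter.Tendsto (fun n => groupInv (s n)) Filter.atTop (nhds 0),
       Filter.Tendsto (fun n => coreInv (s n)) Filter.atTop (nhds 0),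
       Filter.Tendsto (fun n => dualCoreInv (s n)) Filter.atTop (nhds 0),
       ∃ C, ∀ n, ‖groupInv (s n)‖ ≤ C,
       ∃ n₀, ∀ n ≥ n₀, s n = 0] ∧
    ((∃ n₀, ∀ n ≥ n₀, s n = 0) ∨ ¬∃ C, ∀ n, ‖groupInv (s n)‖ ≤ C) ∧
    ((¬∃ C, ∀ n, ‖groupInv (s n)‖ ≤ C) ↔ ¬∃ C, ∀ n, ‖coreInv (s n)‖ ≤ C) ∧
    ((¬∃ C, ∀ n, ‖groupInv (s n)‖ ≤ C) ↔ ¬∃ C, ∀ n, ‖dualCoreInv (s n)‖ ≤ C) := by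
  let _ : CStarAlgebra A := { }
  have hg n := isGroupInv_groupInv (hs n)
  have hc n := isCoreInv_coreInv (hg n).exists_isCoreInv
  have hd n := isDualCoreInv_dualCoreInv (hg n).exists_isDualCoreInv
  have hcb := bounded_groupInv_iff hconv (fun n => (hc n).norm_le (hg n))
    (fun n => (hc n).norm_groupInv_le (hg n))
  have hdb := bounded_groupInv_iff hconv (fun n => (hd n).norm_le (hg n))
    (fun n => (hd n).norm_groupInv_le (hg n))
  have hzero := eventually_eq_zero_of_bounded_groupInv hg hconv
  have hlim : (∃ n₀, ∀ n ≥ n₀, s n = 0) →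
      Filter.Tendsto (fun n => groupInv (s n)) Filter.atTop (nhds 0) := by
    rintro ⟨n₀, hn₀⟩
    refine tendsto_const_nhds.congr' ?_
    filter_upwards [Filter.eventually_ge_atTop n₀] with n hn
    rw [← (hg n).2.1, hn₀ n hn, mul_zero, zero_mul]
  refine ⟨?_, (em _).imp hzero id, not_congr hcb, not_congr hdb⟩
  tfae_have 1 → 2 := fun h =>
    squeeze_zero_norm (fun n => (hc n).norm_le (hg n)) (by simpa using h.norm)
  tfae_have 1 → 3 := fun h =>
    squeeze_zero_norm (fun n => (hd n).norm_le (hg n)) (by simpa using h.norm)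
  tfae_have 2 → 4 := fun h => hcb.mpr (bounded_of_tendsto_zero h)
  tfae_have 3 → 4 := fun h => hdb.mpr (bounded_of_tendsto_zero h)
  tfae_have 4 → 5 := hzero
  tfae_have 5 → 1 := hlim
  tfae_finish
end

section
/- Let A be a unital C*-algebra, let a ∈ A be core invertible (equivalently, dual core invertible) with a ≠ 0, and let (a_n) be a sequence of core invertible elements of A converging in norm to a. The following statements are equivalent: (i) (a_n⊕) converges to a⊕; (ii) (a_n·a_n⊕) converges to a·a⊕; (iii) θ(a_n·A, a·A) → 0 and θ((a_n*)°, (a*)°) → 0; (iv) θ(A·a_n*, A·a*) → 0 and θ(°a_n, °a) → 0; (v) (a_n⊖) converges to a⊖; (vi) (a_n⊖·a_n) converges to a⊖·a; (vii) θ(a_n*·A, a*·A) → 0 and θ(a_n°, a°) → 0; (viii) θ(A·a_n, A·a) → 0 and θ(°(a_n*), °(a*)) → 0. -/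
open scoped Classical

open Filter Topology

section Algebra

variable {A : Type*} [Ring A] [StarRing A] {a x y : A}

theorem IsCoreInv.mul_star_mul (h : IsCoreInv a x) : x * star (a * x) = x := by
  obtain ⟨h₁, -, h₃⟩ := h
  obtain ⟨y, hy⟩ : x ∈ Set.range fun y => y * star a := h₃ ▸ ⟨1, one_mul x⟩
  have hs : star a * star (a * x) = star a := by rw [← star_mul, h₁]
  calc x * star (a * x) = y * (star a * star (a * x)) := by
        rw [← mul_assoc]; simp only at hy; rw [hy]
    _ = x := by rw [hs]; exact hy

theorem IsCoreInv.star_mul_eq (h : IsCoreInv a x) : star (a * x) = a * x := by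
  have : a * x * star (a * x) = a * x := by rw [mul_assoc, h.mul_star_mul]
  calc star (a * x) = star (a * x * star (a * x)) := by rw [this]
    _ = a * x := by rw [star_mul, star_star, this]

theorem IsCoreInv.inv_mul_mul_self (h : IsCoreInv a x) : x * a * x = x := by
  rw [mul_assoc, ← h.star_mul_eq, h.mul_star_mul]

theorem IsCoreInv.mul_inv_mul_inv (h : IsCoreInv a x) : a * x * x = x := by
  obtain ⟨z, hz⟩ : x ∈ Set.range fun y => a * y := h.2.1 ▸ ⟨1, mul_one x⟩
  simp only at hz
  calc a * x * x = a * x * (a * z) := by rw [hz]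
    _ = a * x * a * z := by rw [mul_assoc (a * x)]
    _ = x := by rw [h.1, hz]

theorem IsCoreInv.inv_mul_mul (h : IsCoreInv a x) : x * a * a = a := by
  obtain ⟨z, hz⟩ : a ∈ Set.range fun y => x * y := h.2.1 ▸ ⟨1, mul_one a⟩
  simp only at hz
  calc x * a * a = x * a * (x * z) := by rw [hz]
    _ = x * a * x * z := by rw [mul_assoc (x * a)]
    _ = a := by rw [h.inv_mul_mul_self, hz]

theorem IsCoreInv.isSelfAdjoint (h : IsCoreInv a x) : IsSelfAdjoint (a * x) := h.star_mul_eq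

theorem IsCoreInv.isIdempotentElem (h : IsCoreInv a x) : IsIdempotentElem (a * x) := by
  rw [IsIdempotentElem, ← mul_assoc, h.1]

theorem IsCoreInv.rIdeal_eq (h : IsCoreInv a x) : rIdeal a = rIdeal (a * x) := by
  apply Set.Subset.antisymm
  · rintro _ ⟨y, rfl⟩
    exact ⟨a * y, by simp only [← mul_assoc, h.1]⟩
  · rintro _ ⟨y, rfl⟩
    exact ⟨x * y, (mul_assoc _ _ _).symm⟩

theorem IsCoreInv.rAnn_star_eq (h : IsCoreInv a x) : rAnn (star a) = rIdeal (1 - a * x) := by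
  have hs : star a * (a * x) = star a := by rw [← h.star_mul_eq, ← star_mul, h.1]
  have hs' : a * x = star x * star a := by rw [← star_mul, h.star_mul_eq]
  apply Set.Subset.antisymm
  · intro z hz
    exact ⟨z, by simp only; rw [sub_mul, one_mul, hs', mul_assoc, show star a * z = 0 from hz,
      mul_zero, sub_zero]⟩
  · rintro _ ⟨y, rfl⟩
    change star a * ((1 - a * x) * y) = 0
    rw [← mul_assoc, mul_sub, mul_one, hs, sub_self, zero_mul]

/-- The core inverse is determined by the range projection `a * x` as the inverse of a unit, up to a
complementary projection. -/
theorem IsCoreInv.exists_unit (h : IsCoreInv a x) :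
    ∃ u : Aˣ, (u : A) = a * (a * x) + (1 - a * x) ∧ x = ↑u⁻¹ - (1 - a * x) := by
  have h₂ := h.inv_mul_mul_self
  have h₃ := h.mul_inv_mul_inv
  have h₄ := h.inv_mul_mul
  refine ⟨⟨a * (a * x) + (1 - a * x), x + (1 - a * x), ?_, ?_⟩, rfl,
    (add_sub_cancel_right _ _).symm⟩
  · simp only [mul_assoc] at h₂ h₃ h₄ ⊢
    simp only [mul_add, add_mul, mul_sub, sub_mul, mul_one, one_mul, mul_assoc, h₂, h₃]
    abel
  · have h₅ : x * (a * (a * x)) = a * x := by simp only [← mul_assoc, h₄]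
    simp only [mul_assoc] at h₂ h₃ h₄ ⊢
    simp only [mul_add, add_mul, mul_sub, sub_mul, mul_one, one_mul, mul_assoc, h₂, h₅]
    abel

theorem range_star_mul_right (b : A) :
    (Set.range fun y => y * b) = star '' Set.range fun y => star b * y := by
  rw [← Set.range_comp]
  apply Set.Subset.antisymm
  · rintro _ ⟨y, rfl⟩
    exact ⟨star y, by simp⟩
  · rintro _ ⟨y, rfl⟩
    exact ⟨star y, by simp⟩

theorem isCoreInv_star_iff : IsCoreInv (star a) (star x) ↔ IsDualCoreInv a x := by
  have hinj : Function.Injective (Set.image (star : A → A)) := star_injective.image_injective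
  have h₁ : star a * star x * star a = star a ↔ a * x * a = a := by
    rw [← star_mul, ← star_mul, star_inj, mul_assoc]
  rw [IsCoreInv, IsDualCoreInv, h₁, range_star_mul_right x, range_star_mul_right a, hinj.eq_iff,
    range_star_mul_right (star x), range_star_mul_right (star (star a)), hinj.eq_iff,
    star_star, star_star, and_congr_right_iff, and_comm]
  exact fun _ => Iff.rfl

theorem isDualCoreInv_star_iff : IsDualCoreInv (star a) (star x) ↔ IsCoreInv a x := by
  rw [← isCoreInv_star_iff, star_star, star_star]

theorem coreInv_spec (h : ∃ x, IsCoreInv a x) : IsCoreInv a (coreInv a) := by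
  rw [coreInv, dif_pos h]
  exact h.choose_spec

theorem dualCoreInv_spec (h : ∃ x, IsDualCoreInv a x) : IsDualCoreInv a (dualCoreInv a) := by
  rw [dualCoreInv, dif_pos h]
  exact h.choose_spec

theorem lIdeal_eq_image_star (b : A) : lIdeal (star b) = star '' rIdeal b := by
  rw [lIdeal, range_star_mul_right, star_star, rIdeal]

theorem lAnn_eq_image_star (b : A) : lAnn b = star '' rAnn (star b) := by
  ext z
  constructor
  · intro hz
    refine ⟨star z, ?_, star_star z⟩
    change star b * star z = 0
    rw [← star_mul, show z * b = 0 from hz, star_zero]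
  · rintro ⟨w, hw, rfl⟩
    change star w * b = 0
    rw [← star_star b, ← star_mul, show star b * w = 0 from hw, star_zero]

/-- If `a * star a + (1 - a * x)` is invertible, it yields the projection onto the range of
`star a`. -/
theorem IsCoreInv.mul_star_mul_inverse_mul (h : IsCoreInv a x) (v : Aˣ)
    (hv : (v : A) = a * star a + (1 - a * x)) : a * (star a * ↑v⁻¹ * a) = a := by
  have hpa : (1 - a * x) * a = 0 := by rw [sub_mul, one_mul, h.1, sub_self]
  have hap : star a * (a * x) = star a := by rw [← h.star_mul_eq, ← star_mul, h.1]
  have hc : Commute (v : A) (1 - a * x) := by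
    rw [Commute, SemiconjBy, hv, add_mul, mul_add, mul_assoc a, mul_sub (star a), hap, mul_one,
      sub_self, mul_zero, ← mul_assoc _ a, hpa, zero_mul]
  have hc' : Commute (↑v⁻¹ : A) (1 - a * x) := hc.units_inv_left
  have haa : a * star a = v - (1 - a * x) := by rw [hv, add_sub_cancel_right]
  calc a * (star a * ↑v⁻¹ * a) = (a * star a) * ↑v⁻¹ * a := by simp only [mul_assoc]
    _ = a - ↑v⁻¹ * ((1 - a * x) * a) := by
      rw [haa, sub_mul, Units.mul_inv, sub_mul, one_mul, ← hc'.eq, mul_assoc]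
    _ = a := by rw [hpa, mul_zero, sub_zero]

theorem star_units_inv_of_isSelfAdjoint (v : Aˣ) (hv : IsSelfAdjoint (v : A)) :
    star (↑v⁻¹ : A) = ↑v⁻¹ := by
  have : star v = v := Units.ext hv
  rw [← Units.coe_star, star_inv, this]

theorem IsCoreInv.isSelfAdjoint_mul_star_add (h : IsCoreInv a x) :
    IsSelfAdjoint (a * star a + (1 - a * x)) :=
  (IsSelfAdjoint.mul_star_self a).add ((IsSelfAdjoint.one A).sub h.isSelfAdjoint)

theorem IsCoreInv.dual_mul_eq (h : IsCoreInv a x) (hy : IsDualCoreInv a y) (v : Aˣ)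
    (hv : (v : A) = a * star a + (1 - a * x)) : y * a = star a * ↑v⁻¹ * a := by
  have hq := h.mul_star_mul_inverse_mul v hv
  have hys : star (y * a) = y * a := by
    have := (isCoreInv_star_iff.2 hy).star_mul_eq
    rw [← star_mul, star_star] at this
    exact this.symm
  have hya : y * a * star a = star a := by
    rw [← hys, ← star_mul, ← mul_assoc, hy.1]
  calc y * a = y * (a * (star a * ↑v⁻¹ * a)) := by rw [hq]
    _ = y * a * star a * ↑v⁻¹ * a := by simp only [mul_assoc]
    _ = star a * ↑v⁻¹ * a := by rw [hya]

theorem IsCoreInv.isDualCoreInv_of_unit (h : IsCoreInv a x) (v : Aˣ)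
    (hv : (v : A) = a * star a + (1 - a * x)) : IsDualCoreInv a (star a * ↑v⁻¹ * x * a) := by
  have hq := h.mul_star_mul_inverse_mul v hv
  have hsa := star_units_inv_of_isSelfAdjoint v (hv ▸ h.isSelfAdjoint_mul_star_add)
  have hqs : star a * ↑v⁻¹ * a * star a = star a := by
    have := congrArg star hq
    simpa only [star_mul, star_star, hsa, mul_assoc] using this
  have hay : a * (star a * ↑v⁻¹ * x * a) = x * a := by
    calc a * (star a * ↑v⁻¹ * x * a) = a * (star a * ↑v⁻¹ * (a * x * x) * a) := by
          rw [h.mul_inv_mul_inv]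
      _ = a * (star a * ↑v⁻¹ * a) * x * x * a := by simp only [mul_assoc]
      _ = x * a := by rw [hq, h.mul_inv_mul_inv]
  refine ⟨by rw [hay, h.inv_mul_mul], ?_, ?_⟩
  · apply Set.Subset.antisymm
    · rintro _ ⟨z, rfl⟩
      exact ⟨↑v⁻¹ * x * a * z, by simp only [mul_assoc]⟩
    · rintro _ ⟨z, rfl⟩
      refine ⟨a * star a * z, ?_⟩
      calc star a * ↑v⁻¹ * x * a * (a * star a * z)
          = star a * ↑v⁻¹ * (x * a * a) * star a * z := by simp only [mul_assoc]
        _ = star a * z := by rw [h.inv_mul_mul, hqs]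
  · apply Set.Subset.antisymm
    · rintro _ ⟨z, rfl⟩
      exact ⟨z * (star a * ↑v⁻¹ * x), by simp only [mul_assoc]⟩
    · rintro _ ⟨z, rfl⟩
      refine ⟨z * a * a, ?_⟩
      simp only
      rw [mul_assoc (z * a) a, hay, mul_assoc z, ← mul_assoc a x a, h.1]

end Algebra

section Gap

theorem subDelta_nonneg {E : Type*} [NormedAddCommGroup E] (M N : Set E) : 0 ≤ subDelta M N := by
  rw [subDelta]
  split_ifs
  · exact le_rfl
  · apply Real.sSup_nonneg
    rintro _ ⟨m, -, rfl⟩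
    exact Metric.infDist_nonneg

theorem subDelta_image_star {A : Type*} [NormedAddCommGroup A] [StarAddMonoid A]
    [NormedStarGroup A] (M N : Set A) : subDelta (star '' M) (star '' N) = subDelta M N := by
  have h0 : star '' M = {0} ↔ M = {0} := by
    rw [← (star_injective (R := A)).image_injective.eq_iff (a := M), Set.image_singleton, star_zero]
  have hs : {m ∈ star '' M | ‖m‖ = 1} = star '' {m ∈ M | ‖m‖ = 1} := by
    ext z
    constructor
    · rintro ⟨⟨m, hm, rfl⟩, h⟩
      exact ⟨m, ⟨hm, by rwa [norm_star] at h⟩, rfl⟩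
    · rintro ⟨m, ⟨hm, h⟩, rfl⟩
      exact ⟨⟨m, hm, rfl⟩, by rwa [norm_star]⟩
  rw [subDelta, subDelta, hs, Set.image_image]
  simp only [h0, Metric.infDist_image (star_isometry (E := A))]

theorem subGap_image_star {A : Type*} [NormedAddCommGroup A] [StarAddMonoid A]
    [NormedStarGroup A] (M N : Set A) : subGap (star '' M) (star '' N) = subGap M N := by
  rw [subGap, subGap, subDelta_image_star, subDelta_image_star]

variable {A : Type*} [NormedRing A] [StarRing A] [CStarRing A] {p q : A}

theorem IsIdempotentElem.norm_eq_one_of_isSelfAdjoint (hp : IsIdempotentElem p)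
    (hps : IsSelfAdjoint p) (h : p ≠ 0) : ‖p‖ = 1 := by
  have h₁ : ‖p‖ = ‖p‖ * ‖p‖ := by
    rw [← CStarRing.norm_star_mul_self, hps.star_eq, hp.eq]
  exact (mul_eq_left₀ (norm_ne_zero_iff.2 h)).1 h₁.symm

theorem IsIdempotentElem.norm_le_one_of_isSelfAdjoint (hp : IsIdempotentElem p)
    (hps : IsSelfAdjoint p) : ‖p‖ ≤ 1 := by
  by_cases h : p = 0
  · simp [h]
  · exact (hp.norm_eq_one_of_isSelfAdjoint hps h).le

theorem subDelta_rIdeal_le {A : Type*} [NormedRing A] {p q : A} (hp : IsIdempotentElem p) :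
    subDelta (rIdeal p) (rIdeal q) ≤ ‖p - q‖ := by
  rw [subDelta]
  split_ifs
  · exact norm_nonneg _
  · apply Real.sSup_le _ (norm_nonneg _)
    rintro _ ⟨_, ⟨⟨y, rfl⟩, hy⟩, rfl⟩
    simp only at hy ⊢
    calc Metric.infDist (p * y) (rIdeal q) ≤ dist (p * y) (q * (p * y)) :=
          Metric.infDist_le_dist_of_mem ⟨_, rfl⟩
      _ = ‖(p - q) * (p * y)‖ := by rw [dist_eq_norm, sub_mul, ← mul_assoc p p, hp.eq]
      _ ≤ ‖p - q‖ * ‖p * y‖ := norm_mul_le _ _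
      _ = ‖p - q‖ := by rw [hy, mul_one]

theorem norm_one_sub_mul_le_subDelta (hp : IsIdempotentElem p) (hps : IsSelfAdjoint p)
    (hq : IsIdempotentElem q) (hqs : IsSelfAdjoint q) :
    ‖(1 - q) * p‖ ≤ subDelta (rIdeal p) (rIdeal q) := by
  by_cases h0 : p = 0
  · rw [h0, mul_zero, norm_zero]
    exact subDelta_nonneg _ _
  have hmem : p ∈ rIdeal p := ⟨1, mul_one p⟩
  have hne : rIdeal p ≠ {0} := fun h => h0 (by simpa [h] using hmem)
  have h1q : ‖1 - q‖ ≤ 1 := hq.one_sub.norm_le_one_of_isSelfAdjoint ((IsSelfAdjoint.one A).sub hqs)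
  have hz : (0 : A) ∈ rIdeal q := ⟨0, mul_zero q⟩
  rw [subDelta, if_neg hne]
  have hbdd : BddAbove ((fun m => Metric.infDist m (rIdeal q)) '' {m ∈ rIdeal p | ‖m‖ = 1}) := by
    refine ⟨1, ?_⟩
    rintro _ ⟨m, ⟨-, hm⟩, rfl⟩
    simpa [hm] using Metric.infDist_le_dist_of_mem (x := m) hz
  refine le_trans ?_ (le_csSup hbdd ⟨p, ⟨hmem, hp.norm_eq_one_of_isSelfAdjoint hps h0⟩, rfl⟩)
  refine (Metric.le_infDist ⟨0, hz⟩).2 ?_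
  rintro _ ⟨y, rfl⟩
  have : (1 - q) * p = (1 - q) * (p - q * y) := by
    rw [mul_sub, ← mul_assoc, sub_mul 1 q q, one_mul, hq.eq, sub_self, zero_mul, sub_zero]
  calc ‖(1 - q) * p‖ ≤ ‖1 - q‖ * ‖p - q * y‖ := this ▸ norm_mul_le _ _
    _ ≤ 1 * ‖p - q * y‖ := by gcongr
    _ = dist p (q * y) := by rw [one_mul, dist_eq_norm]

theorem norm_sub_le_two_mul_subGap (hp : IsIdempotentElem p) (hps : IsSelfAdjoint p)
    (hq : IsIdempotentElem q) (hqs : IsSelfAdjoint q) :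
    ‖p - q‖ ≤ 2 * subGap (rIdeal p) (rIdeal q) := by
  have h₁ : ‖q * (1 - p)‖ = ‖(1 - p) * q‖ := by
    rw [← norm_star, star_mul, hqs.star_eq, star_sub, star_one, hps.star_eq]
  have h₂ : p - q = (1 - q) * p - q * (1 - p) := by noncomm_ring
  calc ‖p - q‖ ≤ ‖(1 - q) * p‖ + ‖(1 - p) * q‖ := by rw [h₂, ← h₁]; exact norm_sub_le _ _
    _ ≤ subGap (rIdeal p) (rIdeal q) + subGap (rIdeal p) (rIdeal q) :=
      add_le_add ((norm_one_sub_mul_le_subDelta hp hps hq hqs).trans (le_max_left _ _))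
        ((norm_one_sub_mul_le_subDelta hq hqs hp hps).trans (le_max_right _ _))
    _ = _ := (two_mul _).symm

theorem subGap_rIdeal_le {A : Type*} [NormedRing A] {p q : A} (hp : IsIdempotentElem p)
    (hq : IsIdempotentElem q) : subGap (rIdeal p) (rIdeal q) ≤ ‖p - q‖ :=
  max_le (subDelta_rIdeal_le hp) (norm_sub_rev p q ▸ subDelta_rIdeal_le hq)

theorem tendsto_projection_iff_tendsto_subGap {P : ℕ → A} (hP : ∀ n, IsIdempotentElem (P n))
    (hPs : ∀ n, IsSelfAdjoint (P n)) (hq : IsIdempotentElem q) (hqs : IsSelfAdjoint q) :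
    Tendsto P atTop (𝓝 q) ↔ Tendsto (fun n => subGap (rIdeal (P n)) (rIdeal q)) atTop (𝓝 0) := by
  rw [tendsto_iff_norm_sub_tendsto_zero]
  constructor
  · exact squeeze_zero (fun n => le_max_of_le_left (subDelta_nonneg _ _))
      fun n => subGap_rIdeal_le (hP n) hq
  · intro h
    refine squeeze_zero (fun n => norm_nonneg _)
      (fun n => norm_sub_le_two_mul_subGap (hP n) (hPs n) hq hqs) ?_
    simpa using h.const_mul 2

end Gap

section Convergence

theorem IsCoreInv.isUnit_mul_star_add {A : Type*} [CStarAlgebra A] {a x : A}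
    (h : IsCoreInv a x) : IsUnit (a * star a + (1 - a * x)) := by
  let _ := CStarAlgebra.spectralOrder A
  have _ := CStarAlgebra.spectralOrderedRing A
  have hp : 0 ≤ 1 - a * x := by
    have : star (1 - a * x) * (1 - a * x) = 1 - a * x := by
      rw [star_sub, star_one, h.star_mul_eq, h.isIdempotentElem.one_sub.eq]
    exact this ▸ star_mul_self_nonneg _
  have hconj : a * x ≤ ‖x * star x‖ • (a * star a) := by
    have := CStarAlgebra.star_right_conjugate_le_norm_smul (a := a) (b := x * star x)
      (IsSelfAdjoint.mul_star_self x)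
    rwa [← mul_assoc a, mul_assoc (a * x), ← star_mul, h.star_mul_eq, h.isIdempotentElem.eq]
      at this
  have hC : (0 : ℝ) < 1 + ‖x * star x‖ := by positivity
  have hle : 1 ≤ (1 + ‖x * star x‖) • (a * star a + (1 - a * x)) := by
    calc (1 : A) = a * x + (1 - a * x) := (add_sub_cancel _ _).symm
      _ ≤ ‖x * star x‖ • (a * star a) + (1 - a * x) := by gcongr
      _ ≤ ‖x * star x‖ • (a * star a) + (1 - a * x) +
          (a * star a + ‖x * star x‖ • (1 - a * x)) :=
        le_add_of_nonneg_right
          (add_nonneg (mul_star_self_nonneg a) (smul_nonneg (norm_nonneg _) hp))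
      _ = (1 + ‖x * star x‖) • (a * star a + (1 - a * x)) := by
        rw [add_smul, one_smul, smul_add]
        abel
  have hu := CStarAlgebra.isUnit_of_le 1 hle
  exact (isUnit_smul_iff (Units.mk0 _ hC.ne') _).1 hu

variable {A : Type*} [NormedRing A] [StarRing A] [CompleteSpace A] {a x y : A} {s t r : ℕ → A}

theorem IsCoreInv.tendsto_iff (h : IsCoreInv a x) (hs : ∀ n, IsCoreInv (s n) (t n))
    (hconv : Tendsto s atTop (𝓝 a)) :
    Tendsto t atTop (𝓝 x) ↔ Tendsto (fun n => s n * t n) atTop (𝓝 (a * x)) := by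
  refine ⟨hconv.mul, fun hp => ?_⟩
  have key : ∀ {b z : A}, IsCoreInv b z →
      z = Ring.inverse (b * (b * z) + (1 - b * z)) - (1 - b * z) := by
    intro b z hz
    obtain ⟨u, hu, hz'⟩ := hz.exists_unit
    rwa [← hu, Ring.inverse_unit]
  have hcomp : Tendsto (fun n => 1 - s n * t n) atTop (𝓝 (1 - a * x)) := hp.const_sub 1
  have hinv : ContinuousAt Ring.inverse (a * (a * x) + (1 - a * x)) := by
    obtain ⟨u, hu, -⟩ := h.exists_unit
    exact hu ▸ NormedRing.inverse_continuousAt u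
  rw [key h, funext fun n => key (hs n)]
  exact (hinv.tendsto.comp ((hconv.mul hp).add hcomp)).sub hcomp

variable [CStarRing A]

theorem IsCoreInv.tfae_tendsto (h : IsCoreInv a x) (hs : ∀ n, IsCoreInv (s n) (t n))
    (hconv : Tendsto s atTop (𝓝 a)) :
    List.TFAE
      [Tendsto t atTop (𝓝 x),
       Tendsto (fun n => s n * t n) atTop (𝓝 (a * x)),
       Tendsto (fun n => subGap (rIdeal (s n)) (rIdeal a)) atTop (𝓝 0) ∧
         Tendsto (fun n => subGap (rAnn (star (s n))) (rAnn (star a))) atTop (𝓝 0),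
       Tendsto (fun n => subGap (lIdeal (star (s n))) (lIdeal (star a))) atTop (𝓝 0) ∧
         Tendsto (fun n => subGap (lAnn (s n)) (lAnn a)) atTop (𝓝 0)] := by
  tfae_have 1 ↔ 2 := h.tendsto_iff hs hconv
  tfae_have 2 ↔ 3 := by
    simp only [h.rIdeal_eq, h.rAnn_star_eq, (hs _).rIdeal_eq, (hs _).rAnn_star_eq]
    rw [← tendsto_projection_iff_tendsto_subGap (fun n => (hs n).isIdempotentElem)
      (fun n => (hs n).isSelfAdjoint) h.isIdempotentElem h.isSelfAdjoint,
      ← tendsto_projection_iff_tendsto_subGap (fun n => (hs n).isIdempotentElem.one_sub)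
      (fun n => (IsSelfAdjoint.one A).sub (hs n).isSelfAdjoint) h.isIdempotentElem.one_sub
      ((IsSelfAdjoint.one A).sub h.isSelfAdjoint)]
    exact (and_iff_left_of_imp fun hp => hp.const_sub 1).symm
  tfae_have 3 ↔ 4 := by
    simp only [lIdeal_eq_image_star, lAnn_eq_image_star, subGap_image_star]
  tfae_finish

variable [NormedAlgebra ℂ A] [StarModule ℂ A]

theorem IsCoreInv.exists_unit_mul_star_add (h : IsCoreInv a x) :
    ∃ v : Aˣ, (v : A) = a * star a + (1 - a * x) :=
  let _ : CStarAlgebra A := {}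
  h.isUnit_mul_star_add

theorem IsCoreInv.exists_isDualCoreInv (h : IsCoreInv a x) : ∃ y, IsDualCoreInv a y :=
  let ⟨v, hv⟩ := h.exists_unit_mul_star_add
  ⟨_, h.isDualCoreInv_of_unit v hv⟩

theorem IsCoreInv.tendsto_dual_mul (h : IsCoreInv a x) (hs : ∀ n, IsCoreInv (s n) (t n))
    (hy : IsDualCoreInv a y) (hr : ∀ n, IsDualCoreInv (s n) (r n))
    (hconv : Tendsto s atTop (𝓝 a)) (hp : Tendsto (fun n => s n * t n) atTop (𝓝 (a * x))) :
    Tendsto (fun n => r n * s n) atTop (𝓝 (y * a)) := by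
  have key : ∀ {b z w : A}, IsCoreInv b z → IsDualCoreInv b w →
      w * b = star b * Ring.inverse (b * star b + (1 - b * z)) * b := by
    intro b z w hz hw
    obtain ⟨v, hv⟩ := hz.exists_unit_mul_star_add
    rw [← hv, Ring.inverse_unit]
    exact hz.dual_mul_eq hw v hv
  have hinv : ContinuousAt Ring.inverse (a * star a + (1 - a * x)) := by
    obtain ⟨v, hv⟩ := h.exists_unit_mul_star_add
    exact hv ▸ NormedRing.inverse_continuousAt v
  rw [key h hy, funext fun n => key (hs n) (hr n)]
  exact (hconv.star.mul (hinv.tendsto.comp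
    ((hconv.mul hconv.star).add (hp.const_sub 1)))).mul hconv

theorem IsCoreInv.tendsto_mul_iff_tendsto_dual_mul (h : IsCoreInv a x)
    (hs : ∀ n, IsCoreInv (s n) (t n)) (hy : IsDualCoreInv a y)
    (hr : ∀ n, IsDualCoreInv (s n) (r n)) (hconv : Tendsto s atTop (𝓝 a)) :
    Tendsto (fun n => s n * t n) atTop (𝓝 (a * x)) ↔
      Tendsto (fun n => r n * s n) atTop (𝓝 (y * a)) := by
  refine ⟨h.tendsto_dual_mul hs hy hr hconv, fun hq => ?_⟩
  have hq' : Tendsto (fun n => star (s n) * star (r n)) atTop (𝓝 (star a * star y)) := by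
    simpa only [star_mul] using hq.star
  have := ((isCoreInv_star_iff.2 hy).tendsto_dual_mul (fun n => isCoreInv_star_iff.2 (hr n))
    (isDualCoreInv_star_iff.2 h) (fun n => isDualCoreInv_star_iff.2 (hs n)) hconv.star hq').star
  simpa only [star_mul, star_star] using this

end Convergence

theorem stmt8 {A : Type*} [NormedRing A] [StarRing A] [CStarRing A]
    [CompleteSpace A] [NormedAlgebra ℂ A] [StarModule ℂ A]
    (a : A) (ha : ∃ x, IsCoreInv a x) (ha0 : a ≠ 0)
    (s : ℕ → A) (hs : ∀ n, ∃ x, IsCoreInv (s n) x)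
    (hconv : Filter.Tendsto s Filter.atTop (nhds a)) :
    List.TFAE
      [Filter.Tendsto (fun n => coreInv (s n)) Filter.atTop (nhds (coreInv a)),
       Filter.Tendsto (fun n => s n * coreInv (s n)) Filter.atTop (nhds (a * coreInv a)),
       Filter.Tendsto (fun n => subGap (rIdeal (s n)) (rIdeal a)) Filter.atTop (nhds 0) ∧
         Filter.Tendsto (fun n => subGap (rAnn (star (s n))) (rAnn (star a)))
           Filter.atTop (nhds 0),
       Filter.Tendsto (fun n => subGap (lIdeal (star (s n))) (lIdeal (star a)))
           Filter.atTop (nhds 0) ∧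
         Filter.Tendsto (fun n => subGap (lAnn (s n)) (lAnn a)) Filter.atTop (nhds 0),
       Filter.Tendsto (fun n => dualCoreInv (s n)) Filter.atTop (nhds (dualCoreInv a)),
       Filter.Tendsto (fun n => dualCoreInv (s n) * s n) Filter.atTop
         (nhds (dualCoreInv a * a)),
       Filter.Tendsto (fun n => subGap (rIdeal (star (s n))) (rIdeal (star a)))
           Filter.atTop (nhds 0) ∧
         Filter.Tendsto (fun n => subGap (rAnn (s n)) (rAnn a)) Filter.atTop (nhds 0),
       Filter.Tendsto (fun n => subGap (lIdeal (s n)) (lIdeal a)) Filter.atTop (nhds 0) ∧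
         Filter.Tendsto (fun n => subGap (lAnn (star (s n))) (lAnn (star a)))
           Filter.atTop (nhds 0)] := by
  have h := coreInv_spec ha
  have ht := fun n => coreInv_spec (hs n)
  have hd := dualCoreInv_spec h.exists_isDualCoreInv
  have hr := fun n => dualCoreInv_spec (ht n).exists_isDualCoreInv
  have hcore := h.tfae_tendsto ht hconv
  have hdual := (isCoreInv_star_iff.2 hd).tfae_tendsto (fun n => isCoreInv_star_iff.2 (hr n))
    hconv.star
  have star_iff : ∀ {u : ℕ → A} {l : A},
      Tendsto (fun n => star (u n)) atTop (𝓝 (star l)) ↔ Tendsto u atTop (𝓝 l) := fun {u l} =>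
    ⟨fun hu => by simpa only [star_star] using hu.star, fun hu => hu.star⟩
  simp only [← star_mul, star_iff, star_star] at hdual
  tfae_have 1 ↔ 2 := hcore.out 0 1
  tfae_have 2 ↔ 3 := hcore.out 1 2
  tfae_have 3 ↔ 4 := hcore.out 2 3
  tfae_have 2 ↔ 6 := h.tendsto_mul_iff_tendsto_dual_mul ht hd hr hconv
  tfae_have 5 ↔ 6 := hdual.out 0 1
  tfae_have 6 ↔ 7 := hdual.out 1 2
  tfae_have 7 ↔ 8 := hdual.out 2 3
  tfae_finish
end
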